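/- arXiv:2401.02364 — 2 statements merged into one kernel-verified Lean document; each statement's English description precedes it below -/
import Mathlib

section
/- Let n ≥ 1, let U ⊆ ℝ^n be open, and let u : [0,∞) × U → ℂ be smooth, satisfying the wave equation ∂ₜ²u(t,x) = Δₓu(t,x) for all t > 0 and x ∈ U, with initial data f = u(0,·) and g = ∂ₜu(0,·). Assume there exist κ, δ > 0 such that for every compact set L ⊆ U, every j ∈ {0,1,2} and every spatial multi-index α with |α| ≤ 2 one has |∂ₜ^j ∂ₓ^α u(t,x)| ≤ κ·e^{−δt} for all t ≥ 0 and x ∈ L. Then for every complex z with Re z > −δ and every x ∈ U, the Laplace transform v(z,x) = ∫₀^∞ e^{−tz} u(t,x) dt satisfies z²·v(z,x) − Δₓv(z,x) = z·f(x) + g(x). -/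
open MeasureTheory Set

/-- Partial derivative of `φ : ℝⁿ → ℂ` in the `i`-th coordinate direction. -/
noncomputable def coordDeriv {n : ℕ} (i : Fin n)
    (φ : EuclideanSpace ℝ (Fin n) → ℂ) : EuclideanSpace ℝ (Fin n) → ℂ :=
  fun x => fderiv ℝ φ x (EuclideanSpace.single i 1)

/-- Laplacian of `φ : ℝⁿ → ℂ`, as the sum of the second partial derivatives in the
coordinate directions. -/
noncomputable def coordLaplacian {n : ℕ}
    (φ : EuclideanSpace ℝ (Fin n) → ℂ) : EuclideanSpace ℝ (Fin n) → ℂ :=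
  fun x => ∑ i : Fin n, coordDeriv i (coordDeriv i φ) x

open scoped ContDiff

section WaveLaplace

variable {n : ℕ} {U : Set (EuclideanSpace ℝ (Fin n))}
  {w : ℝ → EuclideanSpace ℝ (Fin n) → ℂ}

theorem hasFDerivAt_slice_of_contDiffOn (hU : IsOpen U)
    (hw : ContDiffOn ℝ ∞ (fun p : ℝ × EuclideanSpace ℝ (Fin n) => w p.1 p.2) (Ioi 0 ×ˢ U))
    {t : ℝ} (ht : 0 < t) {y : EuclideanSpace ℝ (Fin n)} (hy : y ∈ U) :
    HasFDerivAt (w t) ((fderiv ℝ (fun p : ℝ × EuclideanSpace ℝ (Fin n) => w p.1 p.2) (t, y)).comp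
      (ContinuousLinearMap.inr ℝ ℝ (EuclideanSpace ℝ (Fin n)))) y := by
  have h1 : DifferentiableAt ℝ (fun p : ℝ × EuclideanSpace ℝ (Fin n) => w p.1 p.2) (t, y) :=
    (hw.contDiffAt ((isOpen_Ioi.prod hU).mem_nhds ⟨mem_Ioi.2 ht, hy⟩)).differentiableAt (by simp)
  exact h1.hasFDerivAt.comp (f := fun y => (t, y)) y (hasFDerivAt_prodMk_right t y)

theorem contDiffOn_coordDeriv (hU : IsOpen U)
    (hw : ContDiffOn ℝ ∞ (fun p : ℝ × EuclideanSpace ℝ (Fin n) => w p.1 p.2) (Ioi 0 ×ˢ U))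
    (i : Fin n) :
    ContDiffOn ℝ ∞ (fun p : ℝ × EuclideanSpace ℝ (Fin n) => coordDeriv i (w p.1) p.2)
      (Ioi 0 ×ˢ U) := by
  have h := (hw.fderiv_of_isOpen (m := ∞) (isOpen_Ioi.prod hU) (by simp)).clm_apply
    (contDiffOn_const (c := ((0 : ℝ), EuclideanSpace.single i (1 : ℝ))))
  refine h.congr ?_
  rintro ⟨t, y⟩ ⟨ht, hy⟩
  simp [coordDeriv, (hasFDerivAt_slice_of_contDiffOn hU hw ht hy).fderiv]

theorem norm_le_sum_norm_apply_single (A : EuclideanSpace ℝ (Fin n) →L[ℝ] ℂ) :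
    ‖A‖ ≤ ∑ i, ‖A (EuclideanSpace.single i 1)‖ := by
  refine A.opNorm_le_bound (Finset.sum_nonneg fun _ _ => norm_nonneg _) fun y => ?_
  have hy : A y = ∑ i, y i • A (EuclideanSpace.single i 1) := by
    conv_lhs => rw [← (EuclideanSpace.basisFun (Fin n) ℝ).sum_repr y]
    simp
  rw [hy, Finset.sum_mul]
  refine norm_sum_le_of_le _ fun i _ => ?_
  rw [norm_smul, mul_comm]
  gcongr
  exact PiLp.norm_apply_le y i

theorem norm_cexp_neg_ofReal_mul (t : ℝ) (z : ℂ) :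
    ‖Complex.exp (-(t : ℂ) * z)‖ = Real.exp (-z.re * t) := by
  rw [Complex.norm_exp]
  congr 1
  simp [mul_comm]

theorem norm_cexp_mul_le {κ δ t : ℝ} {z a : ℂ} (h : ‖a‖ ≤ κ * Real.exp (-δ * t)) :
    ‖Complex.exp (-(t : ℂ) * z) * a‖ ≤ κ * Real.exp (-(z.re + δ) * t) := by
  rw [norm_mul, norm_cexp_neg_ofReal_mul]
  calc _ ≤ Real.exp (-z.re * t) * (κ * Real.exp (-δ * t)) := by gcongr
    _ = κ * (Real.exp (-z.re * t) * Real.exp (-δ * t)) := by ring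
    _ = _ := by rw [← Real.exp_add]; ring_nf

theorem integrableOn_cexp_mul {κ δ : ℝ} {z : ℂ} (hz : -δ < z.re) {a : ℝ → ℂ}
    (hc : ContinuousOn a (Ioi 0)) (ha : ∀ t, 0 < t → ‖a t‖ ≤ κ * Real.exp (-δ * t)) :
    IntegrableOn (fun t : ℝ => Complex.exp (-(t : ℂ) * z) * a t) (Ioi 0) := by
  refine Integrable.mono' ((exp_neg_integrableOn_Ioi 0 (b := z.re + δ) (by linarith)).const_mul κ)
    (ContinuousOn.aestronglyMeasurable (by fun_prop) measurableSet_Ioi) ?_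
  exact (ae_restrict_iff' measurableSet_Ioi).2 (.of_forall fun t ht => norm_cexp_mul_le (ha t ht))

theorem continuousOn_slice
    (hw : ContDiffOn ℝ ∞ (fun p : ℝ × EuclideanSpace ℝ (Fin n) => w p.1 p.2) (Ioi 0 ×ˢ U))
    {y : EuclideanSpace ℝ (Fin n)} (hy : y ∈ U) :
    ContinuousOn (fun t => w t y) (Ioi 0) :=
  hw.continuousOn.comp (f := fun t : ℝ => (t, y)) (by fun_prop) fun _ ht => ⟨ht, hy⟩

/-- Differentiation under the integral sign for the Laplace transform in time. -/
theorem coordDeriv_laplace (hU : IsOpen U)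
    (hw : ContDiffOn ℝ ∞ (fun p : ℝ × EuclideanSpace ℝ (Fin n) => w p.1 p.2) (Ioi 0 ×ˢ U))
    {κ δ : ℝ} (h0 : ∀ t, 0 < t → ∀ y ∈ U, ‖w t y‖ ≤ κ * Real.exp (-δ * t))
    (h1 : ∀ i, ∀ t, 0 < t → ∀ y ∈ U, ‖coordDeriv i (w t) y‖ ≤ κ * Real.exp (-δ * t))
    {z : ℂ} (hz : -δ < z.re) (i : Fin n) {x : EuclideanSpace ℝ (Fin n)} (hx : x ∈ U) :
    coordDeriv i (fun y => ∫ t in Ioi (0 : ℝ), Complex.exp (-(t : ℂ) * z) * w t y) x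
      = ∫ t in Ioi (0 : ℝ), Complex.exp (-(t : ℂ) * z) * coordDeriv i (w t) x := by
  have hmeas : AEStronglyMeasurable
      (fun t : ℝ => Complex.exp (-(t : ℂ) * z) • fderiv ℝ (w t) x)
      (volume.restrict (Ioi 0)) := by
    refine ContinuousOn.aestronglyMeasurable ?_ measurableSet_Ioi
    have hc : ContinuousOn (fun t : ℝ =>
        (fderiv ℝ (fun p : ℝ × EuclideanSpace ℝ (Fin n) => w p.1 p.2) (t, x)).comp
          (ContinuousLinearMap.inr ℝ ℝ (EuclideanSpace ℝ (Fin n)))) (Ioi 0) := by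
      refine ContinuousOn.clm_comp ?_ continuousOn_const
      exact (hw.continuousOn_fderiv_of_isOpen (isOpen_Ioi.prod hU) (by simp)).comp
        (f := fun t : ℝ => (t, x)) (by fun_prop) fun _ ht => ⟨ht, hx⟩
    have he : ContinuousOn (fun t : ℝ => Complex.exp (-(t : ℂ) * z)) (Ioi 0) := by fun_prop
    exact he.smul (hc.congr fun t ht => (hasFDerivAt_slice_of_contDiffOn hU hw ht hx).fderiv)
  have hbound : ∀ t : ℝ, 0 < t → ∀ y ∈ U,
      ‖Complex.exp (-(t : ℂ) * z) • fderiv ℝ (w t) y‖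
        ≤ (n * κ) * Real.exp (-(z.re + δ) * t) := by
    intro t ht y hy
    rw [norm_smul, norm_cexp_neg_ofReal_mul]
    calc _ ≤ Real.exp (-z.re * t) * ∑ _i : Fin n, κ * Real.exp (-δ * t) := by
            gcongr
            exact (norm_le_sum_norm_apply_single _).trans
              (Finset.sum_le_sum fun i _ => h1 i t ht y hy)
      _ = n * κ * (Real.exp (-z.re * t) * Real.exp (-δ * t)) := by simp; ring
      _ = _ := by rw [← Real.exp_add]; ring_nf
  have key := hasFDerivAt_integral_of_dominated_of_fderiv_le
    (μ := volume.restrict (Ioi (0 : ℝ))) (𝕜 := ℝ) (x₀ := x) (s := U)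
    (F := fun y t => Complex.exp (-(t : ℂ) * z) * w t y)
    (F' := fun y t => Complex.exp (-(t : ℂ) * z) • fderiv ℝ (w t) y)
    (bound := fun t => (n * κ) * Real.exp (-(z.re + δ) * t)) (hU.mem_nhds hx)
    (Filter.eventually_of_mem (hU.mem_nhds hx) fun y hy =>
      (integrableOn_cexp_mul hz (continuousOn_slice hw hy)
        fun t ht => h0 t ht y hy).aestronglyMeasurable)
    (integrableOn_cexp_mul hz (continuousOn_slice hw hx) fun t ht => h0 t ht x hx)
    hmeas
    ((ae_restrict_iff' measurableSet_Ioi).2 (.of_forall fun t ht y hy => hbound t ht y hy))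
    ((exp_neg_integrableOn_Ioi 0 (b := z.re + δ) (by linarith)).const_mul _)
    ((ae_restrict_iff' measurableSet_Ioi).2 (.of_forall fun t ht y hy => by
      have := (hasFDerivAt_slice_of_contDiffOn hU hw ht hy).differentiableAt.hasFDerivAt
      exact this.const_smul (Complex.exp (-(t : ℂ) * z))))
  have h_integral : Integrable (fun t : ℝ => Complex.exp (-(t : ℂ) * z) • fderiv ℝ (w t) x)
      (volume.restrict (Ioi 0)) :=
    Integrable.mono' ((exp_neg_integrableOn_Ioi 0 (b := z.re + δ) (by linarith)).const_mul (n * κ))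
      hmeas ((ae_restrict_iff' measurableSet_Ioi).2 (.of_forall fun t ht => hbound t ht x hx))
  rw [coordDeriv, key.fderiv, ContinuousLinearMap.integral_apply h_integral]
  rfl

/-- Integration by parts for the Laplace transform of a second derivative. -/
theorem laplace_second_deriv {φ φ₁ φ₂ : ℝ → ℂ} {κ δ : ℝ} {z : ℂ} (hz : -δ < z.re)
    (hφ : ContinuousOn φ (Ici 0)) (hφ₁ : ContinuousOn φ₁ (Ici 0)) (hφ₂ : ContinuousOn φ₂ (Ici 0))
    (hd : ∀ t, 0 < t → HasDerivAt φ (φ₁ t) t) (hd₁ : ∀ t, 0 < t → HasDerivAt φ₁ (φ₂ t) t)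
    (hb : ∀ t, 0 ≤ t → ‖φ t‖ ≤ κ * Real.exp (-δ * t))
    (hb₁ : ∀ t, 0 ≤ t → ‖φ₁ t‖ ≤ κ * Real.exp (-δ * t))
    (hb₂ : ∀ t, 0 ≤ t → ‖φ₂ t‖ ≤ κ * Real.exp (-δ * t)) :
    z ^ 2 * (∫ t in Ioi (0 : ℝ), Complex.exp (-(t : ℂ) * z) * φ t)
      - ∫ t in Ioi (0 : ℝ), Complex.exp (-(t : ℂ) * z) * φ₂ t = z * φ 0 + φ₁ 0 := by
  have hi := integrableOn_cexp_mul hz (hφ.mono Ioi_subset_Ici_self) fun t ht => hb t ht.le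
  have hi₂ := integrableOn_cexp_mul hz (hφ₂.mono Ioi_subset_Ici_self) fun t ht => hb₂ t ht.le
  have hexp : Filter.Tendsto (fun t : ℝ => κ * Real.exp (-(z.re + δ) * t)) Filter.atTop
      (nhds 0) := by
    have : Filter.Tendsto (fun t : ℝ => -(z.re + δ) * t) Filter.atTop Filter.atBot :=
      Filter.tendsto_id.const_mul_atTop_of_neg (by linarith)
    simpa using (Real.tendsto_exp_atBot.comp this).const_mul κ
  have hlim : ∀ a : ℝ → ℂ, (∀ t, 0 ≤ t → ‖a t‖ ≤ κ * Real.exp (-δ * t)) →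
      Filter.Tendsto (fun t : ℝ => Complex.exp (-(t : ℂ) * z) * a t) Filter.atTop (nhds 0) :=
    fun a ha => squeeze_zero_norm' ((Filter.eventually_ge_atTop 0).mono fun t ht =>
      norm_cexp_mul_le (ha t ht)) hexp
  have hibp := integral_Ioi_of_hasDerivAt_of_tendsto (a := (0 : ℝ)) (m := 0)
    (f := fun t : ℝ => Complex.exp (-(t : ℂ) * z) * φ₁ t
      + z * (Complex.exp (-(t : ℂ) * z) * φ t))
    (f' := fun t : ℝ => Complex.exp (-(t : ℂ) * z) * φ₂ t
      - z ^ 2 * (Complex.exp (-(t : ℂ) * z) * φ t))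
    (by
      have : ContinuousOn (fun t : ℝ => Complex.exp (-(t : ℂ) * z) * φ₁ t
          + z * (Complex.exp (-(t : ℂ) * z) * φ t)) (Ici 0) := by fun_prop
      exact this 0 self_mem_Ici)
    (fun t ht => by
      have he : HasDerivAt (fun t : ℝ => Complex.exp (-(t : ℂ) * z))
          (Complex.exp (-(t : ℂ) * z) * (-1 * z)) t :=
        (((hasDerivAt_id t).ofReal_comp.neg).mul_const z).cexp
      refine ((he.mul (hd₁ t ht)).add ((he.mul (hd t ht)).const_mul z)).congr_deriv ?_
      ring)
    (hi₂.sub (hi.const_mul _))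
    (by simpa using (hlim φ₁ hb₁).add ((hlim φ hb).const_mul z))
  rw [integral_sub hi₂ (hi.const_mul _), integral_const_mul] at hibp
  simp only [Complex.ofReal_zero, neg_zero, zero_mul, Complex.exp_zero, one_mul] at hibp
  linear_combination -hibp

end WaveLaplace

/-- If `u` is a smooth solution of the wave equation `∂ₜ²u = Δₓu` on `(0,∞) × U` with
initial data `f = u(0,·)`, `g = ∂ₜu(0,·)`, all of whose space-time derivatives of order
`≤ 2` in time and `≤ 2` in space decay like `κ e^{-δt}` uniformly on compact subsets of
`U`, then for every `z` with `Re z > -δ` the Laplace transform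
`v(z,x) = ∫₀^∞ e^{-tz} u(t,x) dt` satisfies `z² v(z,x) - Δₓ v(z,x) = z f(x) + g(x)`
on `U`. -/
theorem laplace_transform_of_wave_equation
    (n : ℕ) (hn : 1 ≤ n) (U : Set (EuclideanSpace ℝ (Fin n))) (hU : IsOpen U)
    (u : ℝ → EuclideanSpace ℝ (Fin n) → ℂ) (κ δ : ℝ) (hκ : 0 < κ) (hδ : 0 < δ)
    (hsmooth : ContDiffOn ℝ (⊤ : ℕ∞)
      (fun p : ℝ × EuclideanSpace ℝ (Fin n) => u p.1 p.2) (Ici 0 ×ˢ U))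
    (hwave : ∀ t : ℝ, 0 < t → ∀ x ∈ U,
      deriv (deriv (fun s : ℝ => u s x)) t = coordLaplacian (u t) x)
    (hdecay : ∀ L : Set (EuclideanSpace ℝ (Fin n)), L ⊆ U → IsCompact L →
      ∀ j : ℕ, j ≤ 2 → ∀ ds : List (Fin n), ds.length ≤ 2 →
      ∀ t : ℝ, 0 ≤ t → ∀ x ∈ L,
      ‖(fun φ : ℝ → ℂ => derivWithin φ (Ici 0))^[j]
          (fun s : ℝ => ds.foldr coordDeriv (u s) x) t‖ ≤ κ * Real.exp (-δ * t)) :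
    ∀ z : ℂ, -δ < z.re → ∀ x ∈ U,
      z ^ 2 * (∫ t in Ioi (0 : ℝ), Complex.exp (-(t : ℂ) * z) * u t x)
          - coordLaplacian
              (fun y => ∫ t in Ioi (0 : ℝ), Complex.exp (-(t : ℂ) * z) * u t y) x
        = z * u 0 x + derivWithin (fun s : ℝ => u s x) (Ici 0) 0 := by
  intro z hz x hx
  have hdec : ∀ j ≤ 2, ∀ ds : List (Fin n), ds.length ≤ 2 → ∀ t, 0 ≤ t → ∀ y ∈ U,
      ‖(fun φ : ℝ → ℂ => derivWithin φ (Ici 0))^[j]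
          (fun s : ℝ => ds.foldr coordDeriv (u s) y) t‖ ≤ κ * Real.exp (-δ * t) :=
    fun j hj ds hds t ht y hy => hdecay {y} (singleton_subset_iff.2 hy) isCompact_singleton
      j hj ds hds t ht y rfl
  have hw : ContDiffOn ℝ ∞ (fun p : ℝ × EuclideanSpace ℝ (Fin n) => u p.1 p.2) (Ioi 0 ×ˢ U) :=
    hsmooth.mono (prod_mono Ioi_subset_Ici_self subset_rfl)
  have b0 : ∀ t, 0 < t → ∀ y ∈ U, ‖u t y‖ ≤ κ * Real.exp (-δ * t) :=
    fun t ht => hdec 0 (by simp) [] (by simp) t ht.le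
  have b1 : ∀ i t, 0 < t → ∀ y ∈ U, ‖coordDeriv i (u t) y‖ ≤ κ * Real.exp (-δ * t) :=
    fun i t ht => hdec 0 (by simp) [i] (by simp) t ht.le
  have b2 : ∀ i j t, 0 < t → ∀ y ∈ U,
      ‖coordDeriv j (coordDeriv i (u t)) y‖ ≤ κ * Real.exp (-δ * t) :=
    fun i j t ht => hdec 0 (by simp) [j, i] (by simp) t ht.le
  have hlap : coordLaplacian
      (fun y => ∫ t in Ioi (0 : ℝ), Complex.exp (-(t : ℂ) * z) * u t y) x
      = ∫ t in Ioi (0 : ℝ), Complex.exp (-(t : ℂ) * z) * coordLaplacian (u t) x := by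
    simp only [coordLaplacian, Finset.mul_sum]
    rw [integral_finsetSum]
    · refine Finset.sum_congr rfl fun i _ => ?_
      rw [← coordDeriv_laplace hU (contDiffOn_coordDeriv hU hw i) (b1 i) (b2 i) hz i hx]
      have : coordDeriv i (fun y => ∫ t in Ioi (0 : ℝ), Complex.exp (-(t : ℂ) * z) * u t y)
          =ᶠ[nhds x] fun y => ∫ t in Ioi (0 : ℝ),
            Complex.exp (-(t : ℂ) * z) * coordDeriv i (u t) y :=
        Filter.eventually_of_mem (hU.mem_nhds hx) fun y hy =>
          coordDeriv_laplace hU hw b0 b1 hz i hy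
      simp only [coordDeriv] at this ⊢
      rw [this.fderiv_eq]
    · intro i _
      exact integrableOn_cexp_mul hz
        (continuousOn_slice (w := fun t => coordDeriv i (coordDeriv i (u t)))
          (contDiffOn_coordDeriv (w := fun t => coordDeriv i (u t)) hU
            (contDiffOn_coordDeriv hU hw i) i) hx)
        fun t ht => b2 i i t ht x hx
  set φ : ℝ → ℂ := fun s => u s x
  have c0 : ContDiffOn ℝ ∞ φ (Ici 0) :=
    hsmooth.comp (f := fun t : ℝ => (t, x)) (by fun_prop) fun _ ht => ⟨ht, hx⟩
  have c1 : ContDiffOn ℝ ∞ (derivWithin φ (Ici 0)) (Ici 0) :=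
    c0.derivWithin (uniqueDiffOn_Ici 0) (by simp)
  have c2 : ContDiffOn ℝ ∞ (derivWithin (derivWithin φ (Ici 0)) (Ici 0)) (Ici 0) :=
    c1.derivWithin (uniqueDiffOn_Ici 0) (by simp)
  have hda : ∀ ψ : ℝ → ℂ, ContDiffOn ℝ ∞ ψ (Ici 0) → ∀ t, 0 < t →
      HasDerivAt ψ (derivWithin ψ (Ici 0) t) t := fun ψ hψ t ht =>
    ((hψ.differentiableOn (by simp)) t ht.le).hasDerivWithinAt.hasDerivAt (Ici_mem_nhds ht)
  have hwv : ∀ t, 0 < t →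
      coordLaplacian (u t) x = derivWithin (derivWithin φ (Ici 0)) (Ici 0) t := by
    intro t ht
    rw [← hwave t ht x hx, ← (hda _ c1 t ht).deriv]
    refine Filter.EventuallyEq.deriv_eq ?_
    exact Filter.eventually_of_mem (Ioi_mem_nhds ht) fun s hs => (hda φ c0 s hs).deriv
  have h_integral : ∫ t in Ioi (0 : ℝ), Complex.exp (-(t : ℂ) * z) * coordLaplacian (u t) x
      = ∫ t in Ioi (0 : ℝ), Complex.exp (-(t : ℂ) * z) *
          derivWithin (derivWithin φ (Ici 0)) (Ici 0) t :=
    setIntegral_congr_fun measurableSet_Ioi fun t ht => by simp only [hwv t ht]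
  rw [hlap, h_integral]
  exact laplace_second_deriv hz c0.continuousOn c1.continuousOn c2.continuousOn
    (hda φ c0) (hda _ c1)
    (fun t ht => hdec 0 (by simp) [] (by simp) t ht x hx)
    (fun t ht => hdec 1 (by simp) [] (by simp) t ht x hx)
    (fun t ht => hdec 2 (by simp) [] (by simp) t ht x hx)
end

section
/- Let m ≥ 1, σ ≥ 0, N ≥ 0, let G be a Schwartz function on ℝ^m, and define F(η) = ∫_{ℝ^m} G(x)·e^{−i x·η} dx. Assume |F(η)| ≤ √2·N·e^{σ|η|} for all η ∈ ℝ^m. Then for every ρ > 0: (2π)^{m/2}·‖G‖_{L²(ℝ^m)} ≤ ρ^{−1}·(2π)^{m/2}·‖∇G‖_{L²(ℝ^m)} + √(2·m!·ω_m)·e^{(σ + 1/2)ρ}·N, where ω_m denotes the Lebesgue volume of the unit ball of ℝ^m and ‖∇G‖²_{L²} = ∫ Σⱼ|∂ⱼG(x)|² dx. -/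
open MeasureTheory Set RealInnerProductSpace

open scoped FourierTransform LineDeriv Nat

namespace SchwartzMap

lemma integrable_norm_sq {E F : Type*} [NormedAddCommGroup E] [NormedSpace ℝ E]
    [NormedAddCommGroup F] [NormedSpace ℝ F] [MeasurableSpace E] [BorelSpace E]
    [SecondCountableTopologyEither E F] {μ : Measure E} [μ.HasTemperateGrowth]
    (f : SchwartzMap E F) : Integrable (fun x ↦ ‖f x‖ ^ 2) μ :=
  (f.memLp 2 μ).norm.integrable_sq

variable {m : ℕ} (G : SchwartzMap (EuclideanSpace ℝ (Fin m)) ℂ)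

lemma sum_norm_sq_fourier_lineDeriv (ξ : EuclideanSpace ℝ (Fin m)) :
    ∑ j : Fin m, ‖𝓕 (∂_{EuclideanSpace.single j (1 : ℝ)} G) ξ‖ ^ 2
      = (2 * Real.pi) ^ 2 * (‖ξ‖ ^ 2 * ‖𝓕 G ξ‖ ^ 2) := by
  have h (j : Fin m) : ‖𝓕 (∂_{EuclideanSpace.single j (1 : ℝ)} G) ξ‖ ^ 2
      = (2 * Real.pi) ^ 2 * ‖𝓕 G ξ‖ ^ 2 * ξ j ^ 2 := by
    rw [fourier_lineDerivOp_eq, smul_apply, smulLeftCLM_apply_apply (by fun_prop)]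
    simp [EuclideanSpace.inner_single_right, mul_pow, abs_of_pos Real.pi_pos]
    ring
  simp_rw [h, ← Finset.mul_sum, EuclideanSpace.real_norm_sq_eq ξ]
  ring

lemma integrable_norm_sq_mul_norm_sq_fourier :
    Integrable (fun ξ ↦ ‖ξ‖ ^ 2 * ‖𝓕 G ξ‖ ^ 2) := by
  have h : Integrable (fun ξ ↦
      ∑ j : Fin m, ‖𝓕 (∂_{EuclideanSpace.single j (1 : ℝ)} G) ξ‖ ^ 2) :=
    integrable_finsetSum _ fun j _ ↦ integrable_norm_sq _
  simp_rw [sum_norm_sq_fourier_lineDeriv] at h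
  exact (integrable_const_mul_iff (by simp [Real.pi_ne_zero]) _).1 h

/-- Plancherel's theorem for the gradient of a Schwartz function. -/
lemma integral_sum_norm_sq_fderiv :
    ∫ x, ∑ j : Fin m, ‖fderiv ℝ (⇑G) x (EuclideanSpace.single j 1)‖ ^ 2
      = (2 * Real.pi) ^ 2 * ∫ ξ, ‖ξ‖ ^ 2 * ‖𝓕 G ξ‖ ^ 2 := by
  simp_rw [← lineDerivOp_apply_eq_fderiv]
  rw [integral_finsetSum _ fun j _ ↦ integrable_norm_sq _]
  simp_rw [← integral_norm_sq_fourier (∂_{_} G)]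
  rw [← integral_finsetSum _ fun j _ ↦ integrable_norm_sq _, ← integral_const_mul]
  simp_rw [sum_norm_sq_fourier_lineDeriv]

lemma fourier_eq_integral_mul_exp (ξ : EuclideanSpace ℝ (Fin m)) :
    𝓕 G ξ = ∫ x, G x * Complex.exp (-Complex.I * (⟪x, (2 * Real.pi) • ξ⟫ : ℝ)) := by
  rw [fourier_coe, Real.fourier_eq']
  congr with x
  rw [smul_eq_mul, mul_comm, inner_smul_right]
  congr 2
  push_cast
  ring

/-- Splitting the `L²` norm at frequency `R`: a pointwise bound on the Fourier transform handles
the ball of radius `R`, and the gradient handles its complement. -/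
lemma integral_norm_sq_le_of_norm_fourier_le {R C : ℝ} (hR : 0 < R)
    (hC : ∀ ξ ∈ Metric.closedBall (0 : EuclideanSpace ℝ (Fin m)) R, ‖𝓕 G ξ‖ ^ 2 ≤ C) :
    ∫ x, ‖G x‖ ^ 2 ≤
      ((2 * Real.pi * R) ^ 2)⁻¹ *
          (∫ x, ∑ j : Fin m, ‖fderiv ℝ (⇑G) x (EuclideanSpace.single j 1)‖ ^ 2)
        + R ^ m *
            (volume (Metric.closedBall (0 : EuclideanSpace ℝ (Fin m)) 1)).toReal * C := by
  have hvol : volume.real (Metric.closedBall (0 : EuclideanSpace ℝ (Fin m)) R)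
      = R ^ m * (volume (Metric.closedBall (0 : EuclideanSpace ℝ (Fin m)) 1)).toReal := by
    rw [measureReal_def, Measure.addHaar_closedBall' _ _ hR.le, ENNReal.toReal_mul,
      ENNReal.toReal_ofReal (by positivity), finrank_euclideanSpace_fin]
  have hball : Integrable
      ((Metric.closedBall (0 : EuclideanSpace ℝ (Fin m)) R).indicator fun _ ↦ C) :=
    (integrable_indicator_iff Metric.isClosed_closedBall.measurableSet).2
      (integrableOn_const measure_closedBall_lt_top.ne)
  have htail := G.integrable_norm_sq_mul_norm_sq_fourier.const_mul (R ^ 2)⁻¹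
  calc ∫ x, ‖G x‖ ^ 2 = ∫ ξ, ‖𝓕 G ξ‖ ^ 2 := (integral_norm_sq_fourier G).symm
    _ ≤ ∫ ξ, ((R ^ 2)⁻¹ * (‖ξ‖ ^ 2 * ‖𝓕 G ξ‖ ^ 2) +
          (Metric.closedBall (0 : EuclideanSpace ℝ (Fin m)) R).indicator (fun _ ↦ C) ξ) := by
      refine integral_mono (integrable_norm_sq _) (htail.add hball) fun ξ ↦ ?_
      by_cases hξ : ξ ∈ Metric.closedBall (0 : EuclideanSpace ℝ (Fin m)) R
      · simp only [indicator_of_mem hξ]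
        exact (hC ξ hξ).trans (le_add_of_nonneg_left (by positivity))
      · simp only [indicator_of_notMem hξ, add_zero]
        rw [mem_closedBall_zero_iff, not_le] at hξ
        rw [← mul_assoc]
        refine le_mul_of_one_le_left (by positivity) ?_
        rw [inv_mul_eq_div, one_le_div (by positivity)]
        gcongr
    _ = _ := by
      rw [integral_add htail hball, integral_const_mul,
        integral_indicator_const _ Metric.isClosed_closedBall.measurableSet, hvol,
        integral_sum_norm_sq_fderiv, smul_eq_mul, mul_pow _ R]
      field_simp

end SchwartzMap

/-- Low/high frequency splitting inequality: if `G` is a Schwartz function on `ℝᵐ` whose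
Fourier transform `F(η) = ∫ G(x) e^{-i x·η} dx` satisfies `|F(η)| ≤ √2 N e^{σ|η|}`, then
for every `ρ > 0`,
`(2π)^{m/2} ‖G‖_{L²} ≤ ρ⁻¹ (2π)^{m/2} ‖∇G‖_{L²} + √(2 m! ω_m) e^{(σ+1/2)ρ} N`,
where `ω_m` is the volume of the unit ball of `ℝᵐ`. -/
theorem frequency_splitting_inequality
    (m : ℕ) (hm : 1 ≤ m) (σ N : ℝ) (hσ : 0 ≤ σ) (hN : 0 ≤ N)
    (G : SchwartzMap (EuclideanSpace ℝ (Fin m)) ℂ)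
    (hbound : ∀ η : EuclideanSpace ℝ (Fin m),
      ‖∫ x, G x * Complex.exp (-Complex.I * (⟪x, η⟫ : ℝ))‖
        ≤ Real.sqrt 2 * N * Real.exp (σ * ‖η‖)) :
    ∀ ρ : ℝ, 0 < ρ →
      (2 * Real.pi) ^ ((m : ℝ) / 2) * Real.sqrt (∫ x, ‖G x‖ ^ 2)
        ≤ ρ⁻¹ * (2 * Real.pi) ^ ((m : ℝ) / 2) *
            Real.sqrt
              (∫ x, ∑ j : Fin m, ‖fderiv ℝ (⇑G) x (EuclideanSpace.single j 1)‖ ^ 2)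
          + Real.sqrt (2 * (m.factorial : ℝ) *
                (volume (Metric.closedBall (0 : EuclideanSpace ℝ (Fin m)) 1)).toReal) *
              Real.exp ((σ + 1 / 2) * ρ) * N := by
  intro ρ hρ
  set A := ∫ x, ∑ j : Fin m, ‖fderiv ℝ (⇑G) x (EuclideanSpace.single j 1)‖ ^ 2
  set V := (volume (Metric.closedBall (0 : EuclideanSpace ℝ (Fin m)) 1)).toReal
  have hA : 0 ≤ A := integral_nonneg fun x ↦ by positivity
  have hV : 0 ≤ V := ENNReal.toReal_nonneg
  have hπ : 0 < 2 * Real.pi := by positivity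
  have hlow : ∀ ξ ∈ Metric.closedBall (0 : EuclideanSpace ℝ (Fin m)) (ρ / (2 * Real.pi)),
      ‖𝓕 G ξ‖ ^ 2 ≤ (Real.sqrt 2 * N * Real.exp (σ * ρ)) ^ 2 := by
    intro ξ hξ
    rw [mem_closedBall_zero_iff, le_div_iff₀' hπ] at hξ
    rw [G.fourier_eq_integral_mul_exp]
    refine pow_le_pow_left₀ (norm_nonneg _) ((hbound _).trans ?_) 2
    rw [norm_smul, Real.norm_of_nonneg hπ.le]
    gcongr
  have hsplit := G.integral_norm_sq_le_of_norm_fourier_le (div_pos hρ hπ) hlow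
  rw [mul_div_cancel₀ _ hπ.ne'] at hsplit
  have hfact : ρ ^ m ≤ m ! * Real.exp ρ :=
    (div_le_iff₀' (by positivity)).1 (Real.pow_div_factorial_le_exp ρ hρ.le m)
  have hpow : ((2 * Real.pi) ^ ((m : ℝ) / 2)) ^ 2 = (2 * Real.pi) ^ m := by
    rw [← Real.rpow_mul_natCast hπ.le, Nat.cast_ofNat, div_mul_cancel₀ _ two_ne_zero,
      Real.rpow_natCast]
  have hexp : Real.exp ((σ + 1 / 2) * ρ) ^ 2 = Real.exp (σ * ρ) ^ 2 * Real.exp ρ := by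
    simp only [← Real.exp_nat_mul, ← Real.exp_add]
    congr 1
    push_cast
    ring
  set a := ρ⁻¹ * (2 * Real.pi) ^ ((m : ℝ) / 2) * Real.sqrt A
  set b := Real.sqrt (2 * (m ! : ℝ) * V) * Real.exp ((σ + 1 / 2) * ρ) * N
  have ha : 0 ≤ a := by positivity
  have hb : 0 ≤ b := by positivity
  refine le_of_sq_le_sq ?_ (by positivity)
  calc ((2 * Real.pi) ^ ((m : ℝ) / 2) * Real.sqrt (∫ x, ‖G x‖ ^ 2)) ^ 2
      = (2 * Real.pi) ^ m * ∫ x, ‖G x‖ ^ 2 := by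
        rw [mul_pow, hpow, Real.sq_sqrt (integral_nonneg fun x ↦ by positivity)]
    _ ≤ (2 * Real.pi) ^ m * ((ρ ^ 2)⁻¹ * A + (ρ / (2 * Real.pi)) ^ m * V *
          (Real.sqrt 2 * N * Real.exp (σ * ρ)) ^ 2) := by gcongr
    _ = a ^ 2 + ρ ^ m * (2 * V * N ^ 2 * Real.exp (σ * ρ) ^ 2) := by
        simp only [a, mul_pow, hpow, Real.sq_sqrt hA, Real.sq_sqrt zero_le_two, div_pow, inv_pow]
        field_simp
    _ ≤ a ^ 2 + m ! * Real.exp ρ * (2 * V * N ^ 2 * Real.exp (σ * ρ) ^ 2) := by gcongr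
    _ = a ^ 2 + b ^ 2 := by
        simp only [b, mul_pow, hexp]
        rw [Real.sq_sqrt (by positivity)]
        ring
    _ ≤ (a + b) ^ 2 := by nlinarith [mul_nonneg ha hb]
end
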